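/- Every well-behaved defeasible logic is coherent. Precisely: let conclusions be triples in κ = Bool × Tag × Lit, let X : Name → Bool → (Tag × Lit) → Prop be a family of pre-defined sets, let v be a pure-atom valuation, and take proof atoms Atom = (Tag × Lit) × Option Name, where `none` refers to the current proof. For a list P : List κ define the valuation M_P by M_P s ((d', p), none) := ((s, d', p) ∈ P) and M_P s ((d', p), some n) := X n s (d', p). Suppose for each tag d and literal q a formula C d q is given, and the inference system is defined by Rule (true, d, q) P := eval (C d q) under (M_P, v) and Rule (false, d, q) P := eval (sneg (C d q)) under (M_P, v) (the logic supports the Principle of Strong Negation). Assume (a) the system is stable, and (b) every pre-defined set is coherent: for no n, d', p do X n true (d', p) and X n false (d', p) both hold. Then for no tag d and literal q are both (true, d, q) and (false, d, q) derivable. -/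

import Mathlib

inductive Fml (Atom Pure I : Type) : Type
  | memP (s : Bool) (a : Atom) : Fml Atom Pure I
  | nmemP (s : Bool) (a : Atom) : Fml Atom Pure I
  | pure (p : Pure) : Fml Atom Pure I
  | npure (p : Pure) : Fml Atom Pure I
  | and (A B : Fml Atom Pure I) : Fml Atom Pure I
  | or (A B : Fml Atom Pure I) : Fml Atom Pure I
  | all (f : I → Fml Atom Pure I) : Fml Atom Pure I
  | ex (f : I → Fml Atom Pure I) : Fml Atom Pure I

namespace Fml

variable {Atom Pure I : Type}

def sneg : Fml Atom Pure I → Fml Atom Pure I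
  | memP s a => memP (!s) a
  | nmemP s a => memP s a
  | pure p => npure p
  | npure p => pure p
  | and A B => or A.sneg B.sneg
  | or A B => and A.sneg B.sneg
  | all f => ex fun i => (f i).sneg
  | ex f => all fun i => (f i).sneg

def nnfNeg : Fml Atom Pure I → Fml Atom Pure I
  | memP s a => nmemP s a
  | nmemP s a => memP s a
  | pure p => npure p
  | npure p => pure p
  | and A B => or A.nnfNeg B.nnfNeg
  | or A B => and A.nnfNeg B.nnfNeg
  | all f => ex fun i => (f i).nnfNeg
  | ex f => all fun i => (f i).nnfNeg

def PosOnly : Fml Atom Pure I → Prop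
  | memP _ _ => True
  | nmemP _ _ => False
  | pure _ => True
  | npure _ => True
  | and A B => A.PosOnly ∧ B.PosOnly
  | or A B => A.PosOnly ∧ B.PosOnly
  | all f => ∀ i, (f i).PosOnly
  | ex f => ∀ i, (f i).PosOnly

def NegOnly : Fml Atom Pure I → Prop
  | memP _ _ => False
  | nmemP _ _ => True
  | pure _ => True
  | npure _ => True
  | and A B => A.NegOnly ∧ B.NegOnly
  | or A B => A.NegOnly ∧ B.NegOnly
  | all f => ∀ i, (f i).NegOnly
  | ex f => ∀ i, (f i).NegOnly

def eval (M : Bool → Atom → Prop) (v : Pure → Prop) : Fml Atom Pure I → Prop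
  | memP s a => M s a
  | nmemP s a => ¬ M s a
  | pure p => v p
  | npure p => ¬ v p
  | and A B => A.eval M v ∧ B.eval M v
  | or A B => A.eval M v ∨ B.eval M v
  | all f => ∀ i, (f i).eval M v
  | ex f => ∃ i, (f i).eval M v

end Fml

def IsProof {κ : Type} (Rule : κ → List κ → Prop) (P : List κ) : Prop :=
  ∀ i : Fin P.length, Rule (P.get i) (P.take i.1)

def Stable {κ : Type} (Rule : κ → List κ → Prop) : Prop :=
  ∀ (c : κ) (P Q : List κ), P.Sublist Q → Rule c P → Rule c Q

def Derivable {κ : Type} (Rule : κ → List κ → Prop) (c : κ) : Prop :=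
  ∃ P, IsProof Rule P ∧ c ∈ P

namespace Fml

/-- A formula and its strong negation cannot both hold under a coherent valuation. -/
theorem not_eval_and_eval_sneg {Atom Pure I : Type} {M : Bool → Atom → Prop} {v : Pure → Prop}
    (hM : ∀ a, ¬ (M true a ∧ M false a)) (A : Fml Atom Pure I) :
    ¬ (A.eval M v ∧ A.sneg.eval M v) := by
  induction A with
  | memP s a => cases s <;> simpa [eval, sneg, and_comm] using hM a
  | nmemP s a => exact fun h => h.1 h.2
  | pure p => exact fun h => h.2 h.1
  | npure p => exact fun h => h.1 h.2
  | and A B ihA ihB =>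
    rintro ⟨⟨hA, hB⟩, h | h⟩
    · exact ihA ⟨hA, h⟩
    · exact ihB ⟨hB, h⟩
  | or A B ihA ihB =>
    rintro ⟨h | h, hA, hB⟩
    · exact ihA ⟨h, hA⟩
    · exact ihB ⟨h, hB⟩
  | all f ih =>
    rintro ⟨h, i, hi⟩
    exact ih i ⟨h i, hi⟩
  | ex f ih =>
    rintro ⟨⟨i, hi⟩, h⟩
    exact ih i ⟨hi, h i⟩

end Fml

section Proofs

variable {κ : Type} {Rule : κ → List κ → Prop}

theorem isProof_concat {P : List κ} {c : κ} :
    IsProof Rule (P ++ [c]) ↔ IsProof Rule P ∧ Rule c P := by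
  simp only [IsProof, Fin.forall_iff, List.get_eq_getElem]
  constructor
  · refine fun h => ⟨fun i hi => ?_, ?_⟩
    · simpa [List.getElem_append_left hi, List.take_append_of_le_length hi.le]
        using h i (by simp; omega)
    · simpa using h P.length (by simp)
  · rintro ⟨h, hc⟩ i hi
    obtain hi' | rfl : i < P.length ∨ i = P.length := by
      simp at hi; omega
    · simpa [List.getElem_append_left hi', List.take_append_of_le_length hi'.le] using h i hi'
    · simpa using hc

theorem Stable.isProof_append (hs : Stable Rule) {P Q : List κ}
    (hP : IsProof Rule P) (hQ : IsProof Rule Q) : IsProof Rule (P ++ Q) := by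
  induction Q using List.reverseRecOn with
  | nil => simpa using hP
  | append_singleton Q c ih =>
    obtain ⟨hQ, hc⟩ := isProof_concat.1 hQ
    rw [← List.append_assoc]
    exact isProof_concat.2 ⟨ih hQ, hs _ _ _ (List.sublist_append_right P Q) hc⟩

theorem Stable.rule_of_mem (hs : Stable Rule) {P : List κ} (hP : IsProof Rule P) {c : κ}
    (hc : c ∈ P) : Rule c P := by
  obtain ⟨i, rfl⟩ := List.get_of_mem hc
  exact hs _ _ _ (List.take_sublist _ _) (hP i)

/-- In a stable system, if the conclusions of opposite sign are never both applicable after a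
coherent list, then every proof is coherent. -/
theorem Stable.isProof_coherent {α : Type} {Rule : Bool × α → List (Bool × α) → Prop}
    (hs : Stable Rule)
    (hRule : ∀ P, (∀ a, ¬ ((true, a) ∈ P ∧ (false, a) ∈ P)) →
      ∀ a, ¬ (Rule (true, a) P ∧ Rule (false, a) P))
    {P : List (Bool × α)} (hP : IsProof Rule P) (a : α) :
    ¬ ((true, a) ∈ P ∧ (false, a) ∈ P) := by
  induction P using List.reverseRecOn generalizing a with
  | nil => simp
  | append_singleton P c ih =>
    obtain ⟨hP, hc⟩ := isProof_concat.1 hP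
    have key := hRule P (ih hP) a
    have rule_of_mem_concat : ∀ x ∈ P ++ [c], Rule x P := by
      intro x hx
      rcases List.mem_append.1 hx with hx | hx
      · exact hs.rule_of_mem hP hx
      · rwa [List.mem_singleton.1 hx]
    exact fun h => key ⟨rule_of_mem_concat _ h.1, rule_of_mem_concat _ h.2⟩

end Proofs

theorem well_behaved_is_coherent {Tag Lit Pure I Name : Type}
    (Rule : (Bool × Tag × Lit) → List (Bool × Tag × Lit) → Prop)
    (X : Name → Bool → (Tag × Lit) → Prop)
    (v : Pure → Prop)
    (C : Tag → Lit → Fml ((Tag × Lit) × Option Name) Pure I)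
    (MP : List (Bool × Tag × Lit) → Bool → (Tag × Lit) × Option Name → Prop)
    (hMP : ∀ P s x, MP P s x =
      (match x.2 with
       | none => (s, x.1) ∈ P
       | some n => X n s x.1))
    (hp : ∀ (d : Tag) (q : Lit) (P : List (Bool × Tag × Lit)),
      Rule (true, d, q) P ↔ (C d q).eval (MP P) v)
    (hm : ∀ (d : Tag) (q : Lit) (P : List (Bool × Tag × Lit)),
      Rule (false, d, q) P ↔ (C d q).sneg.eval (MP P) v)
    (hstable : Stable Rule)
    (hXcoherent : ∀ (n : Name) (a : Tag × Lit), ¬ (X n true a ∧ X n false a)) :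
    ¬ ∃ (d : Tag) (q : Lit),
      Derivable Rule (true, d, q) ∧ Derivable Rule (false, d, q) := by
  rintro ⟨d, q, ⟨P, hP, hpos⟩, Q, hQ, hneg⟩
  refine hstable.isProof_coherent ?_ (hstable.isProof_append hP hQ) (d, q)
    ⟨List.mem_append_left _ hpos, List.mem_append_right _ hneg⟩
  rintro R hR ⟨d, q⟩ ⟨hpos, hneg⟩
  refine Fml.not_eval_and_eval_sneg ?_ (C d q) ⟨(hp d q R).1 hpos, (hm d q R).1 hneg⟩
  rintro ⟨a, _ | n⟩
  · simpa only [hMP] using hR a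
  · simpa only [hMP] using hXcoherent n a
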